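/- Let G be a group containing elements z, w, v with v = z w⁻¹, satisfying z⁹ = w⁹ = v⁹ = 1, z w z⁻¹ = w⁴, w z w⁻¹ = z⁴, v z v⁻¹ = z⁴, and z v z⁻¹ = v⁴. Then z³ = w³ = v³ = 1, and z commutes with both w and v. -/

import Mathlib

theorem stmt_5 {G : Type*} [Group G] (z w v : G) (hv : v = z * w⁻¹)
    (hz9 : z ^ 9 = 1) (hw9 : w ^ 9 = 1) (hv9 : v ^ 9 = 1)
    (h1 : z * w * z⁻¹ = w ^ 4) (h2 : w * z * w⁻¹ = z ^ 4)
    (h3 : v * z * v⁻¹ = z ^ 4) (h4 : z * v * z⁻¹ = v ^ 4) :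
    z ^ 3 = 1 ∧ w ^ 3 = 1 ∧ v ^ 3 = 1 ∧ Commute z w ∧ Commute z v := by
  have hconj : w⁻¹ * z * w = z ^ 4 := by
    calc w⁻¹ * z * w = z⁻¹ * (v * z * v⁻¹) * z := by rw [hv]; group
      _ = z ^ 4 := by rw [h3]; group
  have h16 : z = z ^ 16 := by
    calc z = w * (w⁻¹ * z * w) * w⁻¹ := by group
      _ = (w * z * w⁻¹) ^ 4 := by rw [hconj, conj_pow]
      _ = z ^ 16 := by rw [h2, ← pow_mul]
  have h15 : z ^ 15 = 1 := by
    rw [pow_succ] at h16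
    exact right_eq_mul.mp h16
  have hz3 : z ^ 3 = 1 := by
    exact pow_gcd_eq_one.mpr ⟨hz9, h15⟩
  have hwz : Commute w z := by
    rw [pow_succ, hz3, one_mul] at h2
    exact mul_inv_eq_iff_eq_mul.mp h2
  have hw3 : w ^ 3 = 1 := by
    rw [hwz.symm.eq, mul_inv_cancel_right, pow_succ] at h1
    exact right_eq_mul.mp h1
  have hzv : Commute z v := hv ▸ (Commute.refl z).mul_right hwz.symm.inv_right
  refine ⟨hz3, hw3, ?_, hwz.symm, hzv⟩
  rw [hv, hwz.symm.inv_right.mul_pow, inv_pow, hz3, hw3, inv_one, one_mul]
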